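/- Let χ be the characteristic function of the practical numbers and θ(n) = σ(n) + 1. Define η(x) = Σ_{p ≤ x} (log p)/(p − 1) − log x + γ, E(x) = sup_{y ≥ x} |η(y)|, α = Σ_{n ≥ 1} χ(n)·(1/n)·(Σ_{p ≤ θ(n)} (log p)/(p − 1) − log n)·∏_{p ≤ θ(n)} (1 − 1/p), α_N the same sum restricted to n ≤ N, T_N = Σ_{n > N} χ(n)·(1/n)·log(σ(n)/n)·∏_{p ≤ θ(n)} (1 − 1/p), and ε_N = Σ_{n > N} χ(n)·(1/n)·∏_{p ≤ θ(n)} (1 − 1/p). Then for every N ≥ 1: α_N + T_N + ε_N·(−γ − E(2N)) < α < α_N + T_N + ε_N·(−γ + 1/(2N) + E(2N)). -/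

import Mathlib

open scoped BigOperators
open Classical

/-- A positive integer `n` is practical if every positive integer `m ≤ n` can be
expressed as a sum of distinct positive divisors of `n`. -/
def Practical (n : ℕ) : Prop :=
  0 < n ∧ ∀ m : ℕ, 0 < m → m ≤ n → ∃ s : Finset ℕ, s ⊆ n.divisors ∧ ∑ d ∈ s, d = m

/-- The sum of the positive divisors of `n`. -/
def sigma1 (n : ℕ) : ℕ := ∑ d ∈ n.divisors, d

/-- The set of primes `p ≤ x`. -/
noncomputable def primesUpTo (x : ℝ) : Finset ℕ := (Finset.Iic ⌊x⌋₊).filter Nat.Prime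

/-- `∏_{p ≤ σ(n)+1} (1 − 1/p)`, the product over primes `p ≤ θ(n) = σ(n) + 1`. -/
noncomputable def primeProd (n : ℕ) : ℝ :=
  ∏ p ∈ primesUpTo ((sigma1 n : ℝ) + 1), (1 - 1 / (p : ℝ))

/-- `η(x) = Σ_{p ≤ x} (log p)/(p − 1) − log x + γ`. -/
noncomputable def eta (x : ℝ) : ℝ :=
  (∑ p ∈ primesUpTo x, Real.log p / ((p : ℝ) - 1)) - Real.log x + Real.eulerMascheroniConstant

/-- `E(x) = sup_{y ≥ x} |η(y)|`. -/
noncomputable def E (x : ℝ) : ℝ := sSup ((fun y => |eta y|) '' Set.Ici x)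

/-- The `n`-th term of the series defining `α`. -/
noncomputable def alphaTerm (n : ℕ) : ℝ :=
  if Practical n then
    (1 / (n : ℝ)) *
      ((∑ p ∈ primesUpTo ((sigma1 n : ℝ) + 1), Real.log p / ((p : ℝ) - 1)) - Real.log n) *
      primeProd n
  else 0

theorem primesUpTo_eq_primesLE (x : ℝ) : primesUpTo x = ⌊x⌋₊.primesLE := by
  ext p
  simp [primesUpTo, Nat.mem_primesLE]

theorem log_factorial_eq_sum_primesLE (n : ℕ) :
    Real.log (n.factorial : ℝ) =
      ∑ p ∈ n.primesLE, (n.factorial.factorization p : ℝ) * Real.log p := by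
  rw [Real.log_nat_eq_sum_factorization, Finsupp.sum]
  congr 1
  ext p
  simp only [Nat.support_factorization, Nat.mem_primeFactors, Nat.mem_primesLE]
  constructor
  · rintro ⟨hp, hd, -⟩
    exact ⟨hp.dvd_factorial.1 hd, hp⟩
  · rintro ⟨hle, hp⟩
    exact ⟨hp, hp.dvd_factorial.2 hle, n.factorial_ne_zero⟩

theorem sub_one_mul_factorization_factorial_cast {p : ℕ} (hp : p.Prime) (n : ℕ) :
    ((p : ℝ) - 1) * n.factorial.factorization p = n - ((p.digits n).sum : ℝ) := by
  have := Fact.mk hp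
  have h := sub_one_mul_padicValNat_factorial (p := p) n
  rw [← Nat.factorization_def _ hp] at h
  have h' := congrArg (Nat.cast (R := ℝ)) h
  rw [Nat.cast_sub (Nat.digit_sum_le p n), Nat.cast_mul, Nat.cast_sub hp.one_le] at h'
  simpa using h'

theorem digits_sum_cast_le {p n : ℕ} (hp : 1 < p) (hn : n ≠ 0) :
    ((p.digits n).sum : ℝ) ≤ ((p : ℝ) - 1) * (Nat.log p n + 1) := by
  have h := List.sum_le_card_nsmul (p.digits n) (p - 1)
    fun x hx => Nat.le_sub_one_of_lt (Nat.digits_lt_base hp hx)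
  rw [Nat.length_digits p n hp hn, smul_eq_mul] at h
  have h' : ((p.digits n).sum : ℝ) ≤ (((Nat.log p n + 1) * (p - 1) : ℕ) : ℝ) := by exact_mod_cast h
  rw [Nat.cast_mul, Nat.cast_sub hp.le] at h'
  rw [Nat.cast_add_one, Nat.cast_one] at h'
  linarith

/-- A form of Mertens' first theorem. -/
theorem abs_sum_log_div_sub_one_sub_log_le {n : ℕ} (hn : n ≠ 0) :
    |(∑ p ∈ n.primesLE, Real.log p / ((p : ℝ) - 1)) - Real.log n| ≤ 2 * (Real.log 4 + 4) := by
  have hn0 : (0 : ℝ) < n := by positivity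
  have hlog : (n : ℝ) * (∑ p ∈ n.primesLE, Real.log p / ((p : ℝ) - 1)) =
      Real.log (n.factorial : ℝ) +
        ∑ p ∈ n.primesLE, ((p.digits n).sum : ℝ) / ((p : ℝ) - 1) * Real.log p := by
    rw [log_factorial_eq_sum_primesLE, Finset.mul_sum, ← Finset.sum_add_distrib]
    refine Finset.sum_congr rfl fun p hp => ?_
    have hpp := Nat.prime_of_mem_primesLE hp
    have h1 : (0 : ℝ) < (p : ℝ) - 1 := by
      have : (1 : ℝ) < p := by exact_mod_cast hpp.one_lt
      linarith
    have h2 := sub_one_mul_factorization_factorial_cast hpp n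
    field_simp
    linear_combination (-Real.log p) * h2
  have hdig0 : 0 ≤ ∑ p ∈ n.primesLE, ((p.digits n).sum : ℝ) / ((p : ℝ) - 1) * Real.log p := by
    refine Finset.sum_nonneg fun p hp => ?_
    have : (1 : ℝ) < p := by exact_mod_cast (Nat.prime_of_mem_primesLE hp).one_lt
    have := Real.log_pos this
    have : (0 : ℝ) < (p : ℝ) - 1 := by linarith
    positivity
  have hdig : ∑ p ∈ n.primesLE, ((p.digits n).sum : ℝ) / ((p : ℝ) - 1) * Real.log p ≤
      2 * (Real.log 4 + 4) * n := by
    have hpsi := Chebyshev.psi_le_const_mul_self hn0.le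
    have htheta := Chebyshev.theta_le_psi n
    calc
      _ ≤ ∑ p ∈ n.primesLE, (Nat.log p n * Real.log p + Real.log p) := by
        refine Finset.sum_le_sum fun p hp => ?_
        have hpp := (Nat.prime_of_mem_primesLE hp).one_lt
        have h1 : (1 : ℝ) < p := by exact_mod_cast hpp
        have h2 := Real.log_pos h1
        have h3 : (0 : ℝ) < (p : ℝ) - 1 := by linarith
        have h4 : ((p.digits n).sum : ℝ) / ((p : ℝ) - 1) ≤ Nat.log p n + 1 := by
          rw [div_le_iff₀ h3, mul_comm]
          exact digits_sum_cast_le hpp hn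
        nlinarith
      _ = Chebyshev.psi n + Chebyshev.theta n := by
        rw [Finset.sum_add_distrib, Chebyshev.psi_eq_sum_mul_log_prime,
          Chebyshev.theta_eq_sum_primesLE_log]
      _ ≤ _ := by linarith
  have hup : Real.log (n.factorial : ℝ) ≤ n * Real.log n := by
    rw [← Real.log_pow]
    exact Real.log_le_log (by positivity) (by exact_mod_cast n.factorial_le_pow)
  have hlow : n * Real.log n - n ≤ Real.log (n.factorial : ℝ) := by
    have h := Real.pow_div_factorial_le_exp n hn0.le n
    have h' := Real.log_le_log (by positivity) h
    rw [Real.log_exp, Real.log_div (by positivity) (by positivity), Real.log_pow] at h'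
    linarith
  have hl4 : 0 ≤ Real.log 4 := Real.log_nonneg (by norm_num)
  rw [abs_le]
  constructor
  · refine le_of_mul_le_mul_left ?_ hn0
    nlinarith
  · refine le_of_mul_le_mul_left ?_ hn0
    nlinarith

theorem abs_eta_le {y : ℝ} (hy : 1 ≤ y) : |eta y| ≤ 2 * (Real.log 4 + 4) + 2 := by
  have hf : ⌊y⌋₊ ≠ 0 := (Nat.floor_pos.2 hy).ne'
  have hM := abs_sum_log_div_sub_one_sub_log_le hf
  have hf1 : (1 : ℝ) ≤ ⌊y⌋₊ := by exact_mod_cast Nat.one_le_iff_ne_zero.2 hf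
  have h1 : Real.log ⌊y⌋₊ ≤ Real.log y :=
    Real.log_le_log (by linarith) (Nat.floor_le (by linarith))
  have h2 : Real.log y ≤ Real.log ⌊y⌋₊ + 1 := by
    have hlt := Nat.lt_floor_add_one y
    have h3 : Real.log (y / ⌊y⌋₊) ≤ y / ⌊y⌋₊ - 1 :=
      Real.log_le_sub_one_of_pos (by positivity)
    rw [Real.log_div (by positivity) (by positivity)] at h3
    have h4 : y / ⌊y⌋₊ ≤ 2 := by
      rw [div_le_iff₀ (by positivity)]
      linarith
    linarith
  have h5 := Real.one_half_lt_eulerMascheroniConstant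
  have h6 := Real.eulerMascheroniConstant_lt_two_thirds
  rw [eta, primesUpTo_eq_primesLE]
  rw [abs_le] at hM ⊢
  constructor <;> linarith

theorem abs_eta_le_E {x y : ℝ} (hx : 1 ≤ x) (hxy : x ≤ y) : |eta y| ≤ E x := by
  refine le_csSup ⟨2 * (Real.log 4 + 4) + 2, ?_⟩ ⟨y, hxy, rfl⟩
  rintro _ ⟨z, hz, rfl⟩
  exact abs_eta_le (hx.trans hz)

theorem le_sigma1 {n : ℕ} (hn : 0 < n) : n ≤ sigma1 n :=
  Finset.single_le_sum (f := fun d => d) (fun _ _ => Nat.zero_le _)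
    (Nat.mem_divisors_self n hn.ne')

theorem practical_two_pow (k : ℕ) : Practical (2 ^ k) := by
  refine ⟨by positivity, fun m _ hm => ⟨m.bitIndices.toFinset.image (2 ^ ·), ?_, ?_⟩⟩
  · intro d hd
    simp only [Finset.mem_image, List.mem_toFinset] at hd
    obtain ⟨i, hi, rfl⟩ := hd
    have h := (Nat.two_pow_le_of_mem_bitIndices hi).trans hm
    exact Nat.mem_divisors.2
      ⟨pow_dvd_pow 2 ((Nat.pow_le_pow_iff_right (by norm_num)).1 h), by positivity⟩
  · rw [Finset.sum_image fun a _ b _ h => Nat.pow_right_injective le_rfl h]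
    exact Finset.sum_toFinset_bitIndices_two_pow m

theorem Practical.two_mul_le_sigma1_add_one {n : ℕ} (h : Practical n) :
    2 * n ≤ sigma1 n + 1 := by
  obtain ⟨hn, hm⟩ := h
  obtain rfl | h1 : n = 1 ∨ 1 < n := by omega
  · simp [sigma1]
  obtain ⟨s, hs, hsum⟩ := hm (n - 1) (by omega) (by omega)
  have hns : n ∉ s := fun hmem => by
    have := Finset.single_le_sum (f := fun d => d) (fun _ _ => Nat.zero_le _) hmem
    omega
  have hsub : insert n s ⊆ n.divisors :=
    Finset.insert_subset (Nat.mem_divisors_self n hn.ne') hs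
  have hle : ∑ d ∈ insert n s, d ≤ sigma1 n := Finset.sum_le_sum_of_subset hsub
  rw [Finset.sum_insert hns, hsum] at hle
  omega

theorem Practical.dvd_of_mul_eq_mul {a b r s : ℕ} (ha : Practical a) (hb : Practical b)
    (hs : ∀ p, p.Prime → p ≤ sigma1 b + 1 → ¬ p ∣ s)
    (h : a * r = b * s) : a ∣ b := by
  have coprime_of (d : ℕ) (hd : ∀ q, q.Prime → q ∣ d → q ∣ b) : d.Coprime s := by
    refine Nat.Coprime.symm (Nat.coprime_of_dvd fun q hq hqs hqd => ?_)
    have := Nat.le_of_dvd hb.1 (hd q hq hqd)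
    have := le_sigma1 hb.1
    exact hs q hq (by omega) hqs
  have dvd_of (d : ℕ) (hda : d ∣ a) (hd : ∀ q, q.Prime → q ∣ d → q ∣ b) : d ∣ b :=
    (coprime_of d hd).dvd_of_dvd_mul_right (h ▸ hda.mul_right r)
  refine dvd_of a dvd_rfl fun p => ?_
  induction p using Nat.strong_induction_on with
  | _ p ih =>
    intro hp hpa
    have hpa' := Nat.le_of_dvd ha.1 hpa
    have hp2 := hp.two_le
    obtain ⟨t, ht, hsum⟩ := ha.2 (p - 1) (by omega) (by omega)
    have htb : t ⊆ b.divisors := fun d hd => by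
      have hda := Nat.dvd_of_mem_divisors (ht hd)
      have hdp : d ≤ p - 1 := hsum ▸
        Finset.single_le_sum (f := fun d => d) (fun _ _ => Nat.zero_le _) hd
      refine Nat.mem_divisors.2 ⟨dvd_of d hda fun q hq hqd => ?_, hb.1.ne'⟩
      have := Nat.le_of_dvd (Nat.pos_of_dvd_of_pos hda ha.1) hqd
      exact ih q (by omega) hq (hqd.trans hda)
    have hle : ∑ d ∈ t, d ≤ sigma1 b := Finset.sum_le_sum_of_subset htb
    rcases hp.dvd_mul.1 (h ▸ hpa.mul_right r) with h' | h'
    · exact h'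
    · exact absurd h' (hs p hp (by omega))

/-- The integers in `(0, L]` of the form `n * r`, where no prime `p ≤ σ(n) + 1` divides `r`. -/
def roughMultiples (L n : ℕ) : Finset ℕ :=
  {m ∈ Finset.Ioc 0 L | n ∣ m ∧ (primorial (sigma1 n + 1)).Coprime (m / n)}

theorem not_dvd_of_coprime_primorial {k r p : ℕ} (h : (primorial k).Coprime r) (hp : p.Prime)
    (hpk : p ≤ k) : ¬ p ∣ r := fun hr => by
  have hpp : p ∣ primorial k := Finset.dvd_prod_of_mem _ (by simp [hp, hpk])
  exact Nat.not_coprime_of_dvd_of_dvd hp.one_lt hpp hr h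

theorem Practical.eq_of_mem_roughMultiples {a b L m : ℕ} (ha : Practical a) (hb : Practical b)
    (hma : m ∈ roughMultiples L a) (hmb : m ∈ roughMultiples L b) : a = b := by
  obtain ⟨-, hda, hca⟩ := Finset.mem_filter.1 hma
  obtain ⟨-, hdb, hcb⟩ := Finset.mem_filter.1 hmb
  have h : a * (m / a) = b * (m / b) := by rw [Nat.mul_div_cancel' hda, Nat.mul_div_cancel' hdb]
  exact Nat.dvd_antisymm
    (ha.dvd_of_mul_eq_mul hb (fun p hp hle => not_dvd_of_coprime_primorial hcb hp hle) h)
    (hb.dvd_of_mul_eq_mul ha (fun p hp hle => not_dvd_of_coprime_primorial hca hp hle) h.symm)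

theorem card_coprime_Ioc_mul (Q k : ℕ) :
    ({r ∈ Finset.Ioc 0 (Q * k) | Q.Coprime r} : Finset ℕ).card = Q.totient * k := by
  have key : ∀ k, ({r ∈ Finset.Ico 1 (1 + Q * k) | Q.Coprime r} : Finset ℕ).card =
      Q.totient * k := by
    intro k
    induction k with
    | zero => simp
    | succ k ih =>
      rw [mul_add_one, mul_add_one, ← ih, ← Nat.filter_coprime_Ico_eq_totient Q (1 + Q * k),
        ← add_assoc, ← Finset.card_union_of_disjoint, ← Finset.filter_union,
        Finset.Ico_union_Ico_eq_Ico (by omega) (by omega), add_right_comm]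
      exact Finset.disjoint_filter_filter (Finset.Ico_disjoint_Ico_consecutive _ _ _)
  rw [← key k]
  congr 2
  ext; simp; omega

theorem card_roughMultiples_mul {n : ℕ} (hn : 0 < n) (k : ℕ) :
    (roughMultiples (n * (primorial (sigma1 n + 1) * k)) n).card =
      (primorial (sigma1 n + 1)).totient * k := by
  rw [← card_coprime_Ioc_mul]
  symm
  refine Finset.card_bij (fun r _ => n * r) ?_ ?_ ?_
  · intro r hr
    obtain ⟨h1, h2⟩ := Finset.mem_filter.1 hr
    rw [Finset.mem_Ioc] at h1
    refine Finset.mem_filter.2 ⟨Finset.mem_Ioc.2 ⟨Nat.mul_pos hn h1.1, ?_⟩, dvd_mul_right _ _, ?_⟩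
    · exact Nat.mul_le_mul_left n h1.2
    · rwa [Nat.mul_div_cancel_left r hn]
  · intro a _ b _ hab
    exact Nat.eq_of_mul_eq_mul_left hn hab
  · intro m hm
    obtain ⟨h1, ⟨r, rfl⟩, h2⟩ := Finset.mem_filter.1 hm
    rw [Nat.mul_div_cancel_left r hn] at h2
    rw [Finset.mem_Ioc] at h1
    exact ⟨r, Finset.mem_filter.2 ⟨Finset.mem_Ioc.2
      ⟨Nat.pos_of_mul_pos_left h1.1, Nat.le_of_mul_le_mul_left h1.2 hn⟩, h2⟩, rfl⟩

theorem primesUpTo_sigma1_add_one (n : ℕ) :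
    primesUpTo ((sigma1 n : ℝ) + 1) = (sigma1 n + 1).primesLE := by
  rw [primesUpTo_eq_primesLE]
  congr 1
  exact_mod_cast Nat.floor_natCast (R := ℝ) (sigma1 n + 1)

theorem totient_primorial_cast (n : ℕ) :
    ((primorial (sigma1 n + 1)).totient : ℝ) = primorial (sigma1 n + 1) * primeProd n := by
  have h := congrArg (Rat.cast (K := ℝ))
    (Nat.totient_eq_mul_prod_factors (primorial (sigma1 n + 1)))
  rw [primeFactors_primorial] at h
  push_cast at h
  rw [h, primeProd, primesUpTo_sigma1_add_one]
  simp

theorem primeProd_pos (n : ℕ) : 0 < primeProd n := by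
  refine Finset.prod_pos fun p hp => ?_
  rw [primesUpTo_eq_primesLE] at hp
  have : (1 : ℝ) < p := by exact_mod_cast (Nat.prime_of_mem_primesLE hp).one_lt
  rw [sub_pos, div_lt_one (by linarith)]
  exact this

theorem card_roughMultiples_cast {n L : ℕ} (hn : 0 < n)
    (hL : n * primorial (sigma1 n + 1) ∣ L) :
    ((roughMultiples L n).card : ℝ) = L * (1 / n * primeProd n) := by
  obtain ⟨k, rfl⟩ := hL
  rw [mul_assoc n, card_roughMultiples_mul hn k]
  push_cast
  rw [totient_primorial_cast]
  field_simp

theorem sigma1_div_self (m : ℕ) : (sigma1 m : ℝ) / m = ∑ d ∈ m.divisors, 1 / (d : ℝ) := by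
  obtain rfl | hm := Nat.eq_zero_or_pos m
  · simp
  rw [sigma1, ← Nat.sum_div_divisors m fun d => 1 / (d : ℝ)]
  push_cast
  rw [Finset.sum_div]
  refine Finset.sum_congr rfl fun d hd => ?_
  have hdm := Nat.dvd_of_mem_divisors hd
  have hd0 : (d : ℝ) ≠ 0 := by exact_mod_cast (Nat.pos_of_mem_divisors hd).ne'
  rw [Nat.cast_div hdm hd0, one_div_div]

theorem sigma1_div_self_le_of_dvd {n m : ℕ} (hm : m ≠ 0) (h : n ∣ m) :
    (sigma1 n : ℝ) / n ≤ sigma1 m / m := by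
  rw [sigma1_div_self, sigma1_div_self]
  exact Finset.sum_le_sum_of_subset_of_nonneg (Nat.divisors_subset_of_dvd hm h)
    fun _ _ _ => by positivity

theorem sum_sigma1_div_self_le (L : ℕ) :
    ∑ m ∈ Finset.Ioc 0 L, (sigma1 m : ℝ) / m ≤ 2 * L := by
  have hswap : ∑ m ∈ Finset.Ioc 0 L, (sigma1 m : ℝ) / m =
      ∑ d ∈ Finset.Ioc 0 L, ∑ m ∈ Finset.Ioc 0 L with d ∣ m, 1 / (d : ℝ) := by
    simp_rw [sigma1_div_self]
    refine Finset.sum_comm' fun m d => ?_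
    simp only [Finset.mem_Ioc, Nat.mem_divisors, Finset.mem_filter]
    constructor
    · rintro ⟨⟨h1, h2⟩, h3, -⟩
      exact ⟨⟨⟨h1, h2⟩, h3⟩, Nat.pos_of_dvd_of_pos h3 h1, (Nat.le_of_dvd h1 h3).trans h2⟩
    · rintro ⟨⟨h1, h2⟩, -⟩
      exact ⟨h1, h2, h1.1.ne'⟩
  rw [hswap]
  have hsq : ∑ d ∈ Finset.Ioc 0 L, ((d : ℝ) ^ 2)⁻¹ ≤ 2 := by
    have h := sum_Ioo_inv_sq_le (α := ℝ) 0 (L + 1)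
    have he : Finset.Ioo 0 (L + 1) = Finset.Ioc 0 L := by ext; simp
    rw [he] at h
    simpa using h
  calc
    _ ≤ ∑ d ∈ Finset.Ioc 0 L, (L : ℝ) * ((d : ℝ) ^ 2)⁻¹ := by
      refine Finset.sum_le_sum fun d hd => ?_
      rw [Finset.sum_const, Nat.Ioc_filter_dvd_card_eq_div, nsmul_eq_mul]
      have h : ((L / d : ℕ) : ℝ) ≤ L / d := Nat.cast_div_le
      have h0 : (0 : ℝ) ≤ 1 / d := by positivity
      calc _ ≤ (L : ℝ) / d * (1 / d) := mul_le_mul_of_nonneg_right h h0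
        _ = _ := by ring
    _ ≤ _ := by
      rw [← Finset.mul_sum]
      nlinarith [(Nat.cast_nonneg L : (0 : ℝ) ≤ L)]

theorem sum_practical_le (F : Finset ℕ) (hF : ∀ n ∈ F, Practical n) :
    ∑ n ∈ F, (1 / (n : ℝ)) * (sigma1 n / n) * primeProd n ≤ 2 := by
  set L := ∏ n ∈ F, n * primorial (sigma1 n + 1)
  have hL : (0 : ℝ) < L := by
    exact_mod_cast Finset.prod_pos fun n hn => Nat.mul_pos (hF n hn).1 (primorial_pos _)
  refine le_of_mul_le_mul_left ?_ hL
  calc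
    _ = ∑ n ∈ F, ∑ m ∈ roughMultiples L n, (sigma1 n : ℝ) / n := by
      rw [Finset.mul_sum]
      refine Finset.sum_congr rfl fun n hn => ?_
      rw [Finset.sum_const, nsmul_eq_mul,
        card_roughMultiples_cast (hF n hn).1
          (Finset.dvd_prod_of_mem (fun n => n * primorial (sigma1 n + 1)) hn)]
      ring
    _ ≤ ∑ n ∈ F, ∑ m ∈ roughMultiples L n, (sigma1 m : ℝ) / m := by
      refine Finset.sum_le_sum fun n _ => Finset.sum_le_sum fun m hm => ?_
      obtain ⟨h1, h2, -⟩ := Finset.mem_filter.1 hm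
      exact sigma1_div_self_le_of_dvd (Finset.mem_Ioc.1 h1).1.ne' h2
    _ = ∑ m ∈ F.biUnion (roughMultiples L), (sigma1 m : ℝ) / m := by
      refine (Finset.sum_biUnion fun a ha b hb hab => ?_).symm
      exact Finset.disjoint_left.2 fun m hma hmb =>
        hab ((hF a ha).eq_of_mem_roughMultiples (hF b hb) hma hmb)
    _ ≤ ∑ m ∈ Finset.Ioc 0 L, (sigma1 m : ℝ) / m :=
      Finset.sum_le_sum_of_subset_of_nonneg
        (Finset.biUnion_subset.2 fun _ _ => Finset.filter_subset _ _)
        fun _ _ _ => by positivity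
    _ ≤ L * 2 := by linarith [sum_sigma1_div_self_le L]

theorem summable_practical :
    Summable fun n : ℕ =>
      if Practical n then (1 / (n : ℝ)) * (sigma1 n / n) * primeProd n else 0 := by
  refine summable_of_sum_le (c := 2) (fun n => ?_) fun F => ?_
  · have := (primeProd_pos n).le
    dsimp only [Pi.zero_apply]
    split_ifs <;> positivity
  · rw [← Finset.sum_filter]
    exact sum_practical_le _ fun n hn => (Finset.mem_filter.1 hn).2

theorem abs_eta_sigma1_add_one_le {N n : ℕ} (hN : 1 ≤ N) (hn : Practical n) (hNn : N < n) :
    |eta ((sigma1 n : ℝ) + 1)| ≤ E (2 * N) := by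
  have h1 := hn.two_mul_le_sigma1_add_one
  have h2 : (2 * N : ℝ) ≤ (sigma1 n : ℝ) + 1 := by
    exact_mod_cast (by omega : 2 * N ≤ sigma1 n + 1)
  have h3 : (1 : ℝ) ≤ 2 * N := by exact_mod_cast (by omega : 1 ≤ 2 * N)
  exact abs_eta_le_E h3 h2

theorem log_sigma1_add_one_sub_lt {N n : ℕ} (hN : 1 ≤ N) (hn : Practical n) (hNn : N < n) :
    Real.log ((sigma1 n : ℝ) + 1) - Real.log (sigma1 n) < 1 / (2 * N) := by
  have h1 := hn.two_mul_le_sigma1_add_one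
  have hN0 : (0 : ℝ) < N := by exact_mod_cast hN
  have h2 : (2 * N : ℝ) < sigma1 n := by exact_mod_cast (by omega : 2 * N < sigma1 n)
  have hs : (0 : ℝ) < sigma1 n := by linarith
  rw [← Real.log_div (by positivity) (by positivity)]
  calc
    _ ≤ ((sigma1 n : ℝ) + 1) / sigma1 n - 1 := Real.log_le_sub_one_of_pos (by positivity)
    _ = 1 / sigma1 n := by field_simp; ring
    _ < 1 / (2 * N) := one_div_lt_one_div_of_lt (by positivity) h2

theorem alphaTerm_bounds {N n : ℕ} (hN : 1 ≤ N) (hn : Practical n) (hNn : N < n) :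
    (1 / (n : ℝ)) * Real.log ((sigma1 n : ℝ) / n) * primeProd n +
        (1 / (n : ℝ)) * primeProd n * (-Real.eulerMascheroniConstant - E (2 * N)) < alphaTerm n ∧
      alphaTerm n < (1 / (n : ℝ)) * Real.log ((sigma1 n : ℝ) / n) * primeProd n +
        (1 / (n : ℝ)) * primeProd n *
          (-Real.eulerMascheroniConstant + 1 / (2 * N) + E (2 * N)) := by
  have hn0 : (0 : ℝ) < n := by exact_mod_cast hn.1
  have hs0 : (0 : ℝ) < sigma1 n := by exact_mod_cast hn.1.trans_le (le_sigma1 hn.1)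
  have hw : 0 < (1 / (n : ℝ)) * primeProd n := mul_pos (by positivity) (primeProd_pos n)
  have heta := abs_le.1 (abs_eta_sigma1_add_one_le hN hn hNn)
  have hlog := log_sigma1_add_one_sub_lt hN hn hNn
  have hlog' : Real.log (sigma1 n) < Real.log ((sigma1 n : ℝ) + 1) :=
    Real.log_lt_log hs0 (by linarith)
  rw [eta] at heta
  rw [alphaTerm, if_pos hn, Real.log_div hs0.ne' hn0.ne']
  set S := ∑ p ∈ primesUpTo ((sigma1 n : ℝ) + 1), Real.log p / ((p : ℝ) - 1)
  constructor
  · have := mul_lt_mul_of_pos_left (show Real.log (sigma1 n) - Real.log n +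
      (-Real.eulerMascheroniConstant - E (2 * N)) < S - Real.log n by linarith) hw
    linarith
  · have := mul_lt_mul_of_pos_left (show S - Real.log n < Real.log (sigma1 n) - Real.log n +
      (-Real.eulerMascheroniConstant + 1 / (2 * N) + E (2 * N)) by linarith) hw
    linarith

theorem summable_log_sigma1_div_self (N : ℕ) :
    Summable fun n : ℕ => if Practical n ∧ N < n then
      (1 / (n : ℝ)) * Real.log ((sigma1 n : ℝ) / (n : ℝ)) * primeProd n else 0 := by
  refine summable_practical.of_nonneg_of_le (fun n => ?_) fun n => ?_
  · split_ifs with h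
    · have hn0 : (0 : ℝ) < n := by exact_mod_cast h.1.1
      have hl : 0 ≤ Real.log ((sigma1 n : ℝ) / n) := Real.log_nonneg <| by
        rw [one_le_div hn0]
        exact_mod_cast le_sigma1 h.1.1
      have := (primeProd_pos n).le
      positivity
    · exact le_rfl
  · have := (primeProd_pos n).le
    by_cases hn : Practical n
    · rw [if_pos hn]
      split_ifs
      · gcongr
        exact Real.log_le_self (by positivity)
      · positivity
    · simp [hn]

theorem summable_one_div_mul_primeProd (N : ℕ) :
    Summable fun n : ℕ => if Practical n ∧ N < n then (1 / (n : ℝ)) * primeProd n else 0 := by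
  refine summable_practical.of_nonneg_of_le (fun n => ?_) fun n => ?_
  · have := (primeProd_pos n).le
    split_ifs <;> positivity
  · have hP := (primeProd_pos n).le
    by_cases hn : Practical n
    · rw [if_pos hn]
      split_ifs
      · have hn0 : (0 : ℝ) < n := by exact_mod_cast hn.1
        have hl : 1 ≤ (sigma1 n : ℝ) / n := by
          rw [one_le_div hn0]
          exact_mod_cast le_sigma1 hn.1
        gcongr
        exact le_mul_of_one_le_right (by positivity) hl
      · positivity
    · simp [hn]

theorem alpha_sandwich (N : ℕ) (hN : 1 ≤ N) :
    (∑ n ∈ Finset.Iic N, alphaTerm n) +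
      (∑' n : ℕ, if Practical n ∧ N < n then
          (1 / (n : ℝ)) * Real.log ((sigma1 n : ℝ) / (n : ℝ)) * primeProd n else 0) +
      (∑' n : ℕ, if Practical n ∧ N < n then (1 / (n : ℝ)) * primeProd n else 0) *
        (-Real.eulerMascheroniConstant - E (2 * N)) <
      ∑' n : ℕ, alphaTerm n ∧
    (∑' n : ℕ, alphaTerm n) <
      (∑ n ∈ Finset.Iic N, alphaTerm n) +
        (∑' n : ℕ, if Practical n ∧ N < n then
            (1 / (n : ℝ)) * Real.log ((sigma1 n : ℝ) / (n : ℝ)) * primeProd n else 0) +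
        (∑' n : ℕ, if Practical n ∧ N < n then (1 / (n : ℝ)) * primeProd n else 0) *
          (-Real.eulerMascheroniConstant + 1 / (2 * N) + E (2 * N)) := by
  set T : ℕ → ℝ := fun n => if Practical n ∧ N < n then
    (1 / (n : ℝ)) * Real.log ((sigma1 n : ℝ) / (n : ℝ)) * primeProd n else 0
  set e : ℕ → ℝ := fun n => if Practical n ∧ N < n then
    (1 / (n : ℝ)) * primeProd n else 0
  set c₁ := -Real.eulerMascheroniConstant - E (2 * N)
  set c₂ := -Real.eulerMascheroniConstant + 1 / (2 * N) + E (2 * N)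
  set f : ℕ → ℝ := fun n => if n ≤ N then alphaTerm n else 0 with hf
  have hfsum : HasSum f (∑ n ∈ Finset.Iic N, alphaTerm n) := by
    have h : ∑ n ∈ Finset.Iic N, alphaTerm n = ∑ n ∈ Finset.Iic N, f n :=
      Finset.sum_congr rfl fun n hn => (if_pos (Finset.mem_Iic.1 hn)).symm
    rw [h]
    exact hasSum_sum_of_ne_finset_zero fun n hn => if_neg (by simpa using hn)
  have hsum (c : ℝ) : HasSum (fun n => f n + T n + e n * c)
      (∑ n ∈ Finset.Iic N, alphaTerm n + ∑' n, T n + (∑' n, e n) * c) :=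
    (hfsum.add (summable_log_sigma1_div_self N).hasSum).add
      ((summable_one_div_mul_primeProd N).hasSum.mul_right c)
  have hstrict (n : ℕ) (hn : Practical n) (hNn : N < n) :
      f n + T n + e n * c₁ < alphaTerm n ∧ alphaTerm n < f n + T n + e n * c₂ := by
    have h := alphaTerm_bounds hN hn hNn
    have hfn : f n = 0 := if_neg hNn.not_ge
    have hTn : T n = _ := if_pos ⟨hn, hNn⟩
    have hen : e n = _ := if_pos ⟨hn, hNn⟩
    rwa [hfn, hTn, hen, zero_add]
  have hle (n : ℕ) :
      f n + T n + e n * c₁ ≤ alphaTerm n ∧ alphaTerm n ≤ f n + T n + e n * c₂ := by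
    by_cases h : Practical n ∧ N < n
    · exact ⟨(hstrict n h.1 h.2).1.le, (hstrict n h.1 h.2).2.le⟩
    · have hfn : f n = alphaTerm n := by
        rcases not_and_or.1 h with h' | h'
        · simp [hf, alphaTerm, h']
        · exact if_pos (not_lt.1 h')
      have hTn : T n = 0 := if_neg h
      have hen : e n = 0 := if_neg h
      simp [hfn, hTn, hen]
  have hα : HasSum alphaTerm (∑' n, alphaTerm n) := by
    have hdiff : Summable fun n => alphaTerm n - (f n + T n + e n * c₁) :=
      ((hsum c₂).summable.sub (hsum c₁).summable).of_nonneg_of_le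
        (fun n => sub_nonneg.2 (hle n).1) fun n => sub_le_sub_right (hle n).2 _
    simpa using (hdiff.add (hsum c₁).summable).hasSum
  have hpow := hstrict (2 ^ N) (practical_two_pow N) Nat.lt_two_pow_self
  exact ⟨hasSum_lt (fun n => (hle n).1) hpow.1 (hsum c₁) hα,
    hasSum_lt (fun n => (hle n).2) hpow.2 hα (hsum c₂)⟩
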